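/- Propagation of order conditions over root shifts (algebraic core of Theorem 4.5): Let T_alt denote the set of shaped colored rooted trees over 2 shapes and M+1 colors in which no node has a child of the same shape as itself, and let ρ be the tree order. Let ~ be the smallest equivalence relation on T_alt containing all pairs (u∘v, v∘u) for trees u, v ∈ T_alt whose roots have different shapes (note u∘v, v∘u ∈ T_alt and ρ(u∘v) = ρ(v∘u)). Let R be a commutative ring and let A, B : T_alt → R be two functions each satisfying the product identity A(u)·A(v) = A(u∘v) + A(v∘u) and B(u)·B(v) = B(u∘v) + B(v∘u) for all u, v ∈ T_alt with roots of different shapes. If τ, τ′ ∈ T_alt with τ ~ τ′, A(σ) = B(σ) for every σ ∈ T_alt with ρ(σ) < ρ(τ), and A(τ) = B(τ), then A(τ′) = B(τ′). -/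

import Mathlib

/-- Shaped colored rooted trees over `Q` shapes and `M+1` colors, with children
given as a list (unorderedness is handled by the permutation equivalence below). -/
inductive CTree (Q M : ℕ) : Type where
  | node : Fin Q → Fin (M + 1) → List (CTree Q M) → CTree Q M

namespace CTree

mutual
  /-- The order `ρ` of a tree: a node of color `0` (deterministic) contributes `1`,
  a node of color `m ≥ 1` (stochastic) contributes `1/2`. -/
  def rho {Q M : ℕ} : CTree Q M → ℚ
    | .node _ m cs => (if m = 0 then 1 else (1 : ℚ) / 2) + rhoList cs
  /-- Sum of the orders of a list of trees. -/
  def rhoList {Q M : ℕ} : List (CTree Q M) → ℚ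
    | [] => 0
    | c :: cs => rho c + rhoList cs
end

/-- The shape of the root of a tree. -/
def shape {Q M : ℕ} : CTree Q M → Fin Q
  | .node q _ _ => q

/-- The Butcher product: `u ∘ v` attaches `v` by a new branch to the root of `u`. -/
def bprod {Q M : ℕ} : CTree Q M → CTree Q M → CTree Q M
  | .node q m cs, v => .node q m (cs ++ [v])

/-- A tree is alternating if no node has a child of the same shape as itself
(the set `T_alt`). -/
inductive Alt {Q M : ℕ} : CTree Q M → Prop where
  | node (q : Fin Q) (m : Fin (M + 1)) (cs : List (CTree Q M))
      (hs : ∀ c ∈ cs, shape c ≠ q) (hc : ∀ c ∈ cs, Alt c) :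
      Alt (.node q m cs)

/-- Permutation equivalence of trees: two trees are equivalent iff they have the same
root shape and color and their children lists are equal as multisets, up to this
equivalence recursively.  Trees up to `PEquiv` are exactly the shaped colored rooted
trees with an unordered multiset of children at every node. -/
inductive PEquiv {Q M : ℕ} : CTree Q M → CTree Q M → Prop where
  | node (q : Fin Q) (m : Fin (M + 1)) (cs cs' : List (CTree Q M))
      (e : Fin cs.length ≃ Fin cs'.length)
      (h : ∀ i, PEquiv (cs.get i) (cs'.get (e i))) :
      PEquiv (.node q m cs) (.node q m cs')

/-- Generators of the root-shifting relation on alternating trees: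
permutation equivalence (making children unordered) together with all pairs
`(u ∘ v, v ∘ u)` for alternating trees `u`, `v` whose roots have different shapes.
The relation `~` of the paper is the equivalence relation generated by these pairs,
`Relation.EqvGen RootMove`. -/
inductive RootMove {Q M : ℕ} : CTree Q M → CTree Q M → Prop where
  | perm {t t' : CTree Q M} : PEquiv t t' → RootMove t t'
  | shift (u v : CTree Q M) : Alt u → Alt v → shape u ≠ shape v →
      RootMove (bprod u v) (bprod v u)

end CTree

namespace CTree

variable {Q M : ℕ}

lemma rhoList_eq_sum_map (cs : List (CTree Q M)) : rhoList cs = (cs.map rho).sum := by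
  induction cs with
  | nil => simp [rhoList]
  | cons c cs ih => simp [rhoList, ih]

mutual
  lemma rho_pos : ∀ t : CTree Q M, 0 < rho t
    | .node _ m cs => by
      have h := rhoList_nonneg cs
      rw [rho]
      split_ifs <;> linarith
  lemma rhoList_nonneg : ∀ cs : List (CTree Q M), 0 ≤ rhoList cs
    | [] => by simp [rhoList]
    | c :: cs => by
      have h := rho_pos c
      have h' := rhoList_nonneg cs
      rw [rhoList]
      linarith
end

lemma rho_bprod (u v : CTree Q M) : rho (bprod u v) = rho u + rho v := by
  cases u
  simp [bprod, rho, rhoList_eq_sum_map, add_assoc]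

lemma PEquiv.rho_eq {t t' : CTree Q M} (h : PEquiv t t') : rho t = rho t' := by
  induction h with
  | node q m cs cs' e _ ih =>
    have sum_get (l : List (CTree Q M)) : rhoList l = ∑ i, rho (l.get i) := by
      rw [rhoList_eq_sum_map, ← Fin.sum_univ_fun_getElem]
      rfl
    rw [rho, rho, sum_get, sum_get, ← Equiv.sum_comp e]
    exact congrArg _ (Finset.sum_congr rfl fun i _ => ih i)

lemma RootMove.rho_eq {t t' : CTree Q M} (h : RootMove t t') : rho t = rho t' := by
  cases h with
  | perm h => exact h.rho_eq
  | shift u v => rw [rho_bprod, rho_bprod, add_comm]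

/-- Two functions satisfying the product identity that agree on all alternating trees of order
less than `r` agree on both or on neither of two trees of order `r` related by a root move. -/
lemma RootMove.agree_iff {R : Type*} [CommRing R] {A B : CTree Q M → R}
    (hApequiv : ∀ t t' : CTree Q M, t.PEquiv t' → A t = A t')
    (hBpequiv : ∀ t t' : CTree Q M, t.PEquiv t' → B t = B t')
    (hAprod : ∀ u v : CTree Q M, u.Alt → v.Alt → u.shape ≠ v.shape →
      A u * A v = A (u.bprod v) + A (v.bprod u))
    (hBprod : ∀ u v : CTree Q M, u.Alt → v.Alt → u.shape ≠ v.shape →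
      B u * B v = B (u.bprod v) + B (v.bprod u))
    {t t' : CTree Q M} (h : RootMove t t')
    (hlow : ∀ σ : CTree Q M, σ.Alt → σ.rho < t.rho → A σ = B σ) :
    A t = B t ↔ A t' = B t' := by
  cases h with
  | perm h => rw [hApequiv _ _ h, hBpequiv _ _ h]
  | shift u v hu hv huv =>
    rw [rho_bprod] at hlow
    have hAu := hlow u hu (by linarith [rho_pos v])
    have hAv := hlow v hv (by linarith [rho_pos u])
    have hsum : A (u.bprod v) + A (v.bprod u) = B (u.bprod v) + B (v.bprod u) := by
      rw [← hAprod u v hu hv huv, ← hBprod u v hu hv huv, hAu, hAv]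
    constructor <;> intro h
    · rwa [h, add_right_inj] at hsum
    · rwa [h, add_left_inj] at hsum

end CTree

/-- Algebraic core of Theorem 4.5: if two functions `A`, `B` on the alternating trees
over 2 shapes and `M+1` colors (i.e. functions on trees invariant under `PEquiv`)
both satisfy the product identity `A u * A v = A (u ∘ v) + A (v ∘ u)` for alternating
trees with roots of different shapes, `A` and `B` agree on all alternating trees of
order less than `ρ τ` and on `τ` itself, then they agree on every tree `τ'` which is
equivalent to `τ` under the smallest equivalence relation containing the pairs
`(u ∘ v, v ∘ u)`. -/
theorem order_conditions_propagate_over_root_shifts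
    (M : ℕ) (R : Type*) [CommRing R] (A B : CTree 2 M → R)
    (hApequiv : ∀ t t' : CTree 2 M, t.PEquiv t' → A t = A t')
    (hBpequiv : ∀ t t' : CTree 2 M, t.PEquiv t' → B t = B t')
    (hAprod : ∀ u v : CTree 2 M, u.Alt → v.Alt → u.shape ≠ v.shape →
      A u * A v = A (u.bprod v) + A (v.bprod u))
    (hBprod : ∀ u v : CTree 2 M, u.Alt → v.Alt → u.shape ≠ v.shape →
      B u * B v = B (u.bprod v) + B (v.bprod u))
    (τ τ' : CTree 2 M) (hτ : τ.Alt) (hτ' : τ'.Alt)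
    (hrel : Relation.EqvGen CTree.RootMove τ τ')
    (hlow : ∀ σ : CTree 2 M, σ.Alt → σ.rho < τ.rho → A σ = B σ)
    (hroot : A τ = B τ) :
    A τ' = B τ' := by
  have key : τ.rho = τ'.rho ∧ ((∀ σ : CTree 2 M, σ.Alt → σ.rho < τ.rho → A σ = B σ) →
      (A τ = B τ ↔ A τ' = B τ')) := by
    clear hτ hτ' hlow hroot
    induction hrel with
    | rel _ _ h => exact ⟨h.rho_eq, h.agree_iff hApequiv hBpequiv hAprod hBprod⟩
    | refl _ => exact ⟨rfl, fun _ => Iff.rfl⟩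
    | symm _ _ _ ih => exact ⟨ih.1.symm, fun hl => (ih.2 (ih.1 ▸ hl)).symm⟩
    | trans _ _ _ _ _ ih₁ ih₂ =>
      exact ⟨ih₁.1.trans ih₂.1, fun hl => (ih₁.2 hl).trans (ih₂.2 (ih₁.1 ▸ hl))⟩
  exact (key.2 hlow).1 hroot
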